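/- Let X₁ be a J × N real matrix, Y a J × M real matrix, B an N × R real matrix and C an M × R real matrix, and define f(U) = ‖X₁ − U Bᵀ‖² + ‖Y − U Cᵀ‖² (squared Frobenius norms). Fix U with nonnegative entries, indices j, r, set g = (U BᵀB − X₁ B + U CᵀC − Y C)_{j r}, h = (BᵀB)_{r r} + (CᵀC)_{r r} with h > 0, u = U_{j r}, and let U' be U with its (j,r) entry replaced by max(0, u − g/h). Then f(U) − f(U') = g²/h if u ≥ g/h, and f(U) − f(U') = 2·g·u − h·u² if u < g/h. -/

import Mathlib

open scoped BigOperators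
open Matrix

/-- Squared Frobenius norm: sum of squares of the entries. -/
def frobSq {m n : Type*} [Fintype m] [Fintype n] (A : Matrix m n ℝ) : ℝ :=
  ∑ i, ∑ j, A i j ^ 2

/-- Replace the (j,r) entry of U by v. -/
def updEntry {J R : ℕ} (U : Matrix (Fin J) (Fin R) ℝ) (j : Fin J) (r : Fin R) (v : ℝ) :
    Matrix (Fin J) (Fin R) ℝ :=
  Matrix.of fun a b => if a = j ∧ b = r then v else U a b

theorem updEntry_mul_transpose_apply {J N R : ℕ} (U : Matrix (Fin J) (Fin R) ℝ)
    (B : Matrix (Fin N) (Fin R) ℝ) (j : Fin J) (r : Fin R) (v : ℝ) (a : Fin J) (n : Fin N) :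
    (updEntry U j r v * Bᵀ) a n =
      (U * Bᵀ) a n + if a = j then (v - U j r) * B n r else 0 := by
  have hentry (b : Fin R) : updEntry U j r v a b * B n b =
      U a b * B n b + if b = r then (if a = j then (v - U j r) * B n r else 0) else 0 := by
    by_cases ha : a = j <;> by_cases hb : b = r <;> simp [updEntry, ha, hb]
    ring
  simp only [mul_apply, transpose_apply, hentry, Finset.sum_add_distrib, Finset.sum_ite_eq',
    Finset.mem_univ, if_true]

/-- Exact quadratic expansion of a least-squares term in a single entry of the factor. -/
theorem frobSq_sub_updEntry_mul_transpose {J N R : ℕ} (X : Matrix (Fin J) (Fin N) ℝ)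
    (B : Matrix (Fin N) (Fin R) ℝ) (U : Matrix (Fin J) (Fin R) ℝ) (j : Fin J) (r : Fin R)
    (v : ℝ) :
    frobSq (X - updEntry U j r v * Bᵀ) = frobSq (X - U * Bᵀ)
      + 2 * (U * Bᵀ * B - X * B) j r * (v - U j r) + (Bᵀ * B) r r * (v - U j r) ^ 2 := by
  have hrow (a : Fin J) : ∑ n, (X - updEntry U j r v * Bᵀ) a n ^ 2 =
      ∑ n, (X - U * Bᵀ) a n ^ 2 + if a = j then
        2 * (U * Bᵀ * B - X * B) j r * (v - U j r) + (Bᵀ * B) r r * (v - U j r) ^ 2 else 0 := by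
    simp only [Matrix.sub_apply, updEntry_mul_transpose_apply]
    split_ifs with ha
    · subst ha
      rw [mul_apply (M := U * Bᵀ), mul_apply (M := X), mul_apply (M := Bᵀ),
        ← Finset.sum_sub_distrib, Finset.mul_sum, Finset.sum_mul, Finset.sum_mul,
        ← Finset.sum_add_distrib, ← Finset.sum_add_distrib]
      refine Finset.sum_congr rfl fun n _ => ?_
      rw [transpose_apply]
      ring
    · simp
  simp only [frobSq, hrow, Finset.sum_add_distrib, Finset.sum_ite_eq', Finset.mem_univ, if_true]
  ring

/-- Exact objective decrease of a single Cut-CD coordinate update: f(U) − f(U') = g²/h if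
u ≥ g/h, and f(U) − f(U') = 2gu − hu² if u < g/h, where U' replaces the (j,r) entry u of U by
max(0, u − g/h). -/
theorem coordinate_update_exact_decrease {J N M R : ℕ}
    (X₁ : Matrix (Fin J) (Fin N) ℝ) (Y : Matrix (Fin J) (Fin M) ℝ)
    (B : Matrix (Fin N) (Fin R) ℝ) (C : Matrix (Fin M) (Fin R) ℝ)
    (U : Matrix (Fin J) (Fin R) ℝ) (hU : ∀ a b, 0 ≤ U a b) (j : Fin J) (r : Fin R) :
    let f : Matrix (Fin J) (Fin R) ℝ → ℝ :=
      fun A => frobSq (X₁ - A * Bᵀ) + frobSq (Y - A * Cᵀ)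
    let g : ℝ := (U * Bᵀ * B - X₁ * B + U * Cᵀ * C - Y * C) j r
    let h : ℝ := (Bᵀ * B) r r + (Cᵀ * C) r r
    let u : ℝ := U j r
    let U' : Matrix (Fin J) (Fin R) ℝ := updEntry U j r (max 0 (u - g / h))
    0 < h →
    ((g / h ≤ u → f U - f U' = g ^ 2 / h) ∧
      (u < g / h → f U - f U' = 2 * g * u - h * u ^ 2)) := by
  intro f g h u U' hh
  have hg : g = (U * Bᵀ * B - X₁ * B) j r + (U * Cᵀ * C - Y * C) j r := by
    simp only [g, Matrix.sub_apply, Matrix.add_apply]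
    ring
  have hexp : f U - f U' =
      -(2 * g * (max 0 (u - g / h) - u) + h * (max 0 (u - g / h) - u) ^ 2) := by
    simp only [f, U', frobSq_sub_updEntry_mul_transpose]
    rw [hg]
    ring
  refine ⟨fun hle => ?_, fun hlt => ?_⟩
  · rw [hexp, max_eq_right (sub_nonneg.mpr hle)]
    field_simp
    ring
  · rw [hexp, max_eq_left (sub_neg.mpr hlt).le]
    ring
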